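/- arXiv:1711.00233 — 2 statements merged into one kernel-verified Lean document; each statement's English description precedes it below -/
import Mathlib

section
/- The elementary Berezin–Fourier operator F is an equivalence of super Hilbert space structures on Λ: (a) ⟨F x, F y⟩ = ⟨x, y⟩ for all x, y ∈ Λ; and (b) for every α ∈ {0,1}, every x ∈ Λ of parity α, and every y ∈ Λ, S(F x, F y) = c · (−1)^{n·α} · S(x, y), where c = 1 if n is even and c = i if n is odd. -/
/-!
Statement 4: the elementary Berezin–Fourier operator `F` is an equivalence of super
Hilbert space structures on `Λ`:
(a) `⟨F x, F y⟩ = ⟨x, y⟩`;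
(b) for `x` of parity `α`, `S(F x, F y) = c · (−1)^{n·α} · S(x, y)`,
    where `c = 1` if `n` is even and `c = i` if `n` is odd.
-/

noncomputable section

/-- The exterior algebra `Λ` of `ℂⁿ`. -/
abbrev Lam (n : ℕ) : Type := ExteriorAlgebra ℂ (Fin n → ℂ)

/-- The monomial `e^I = ι(e_{i₁}) * ⋯ * ι(e_{i_k})` for `I = {i₁ < ⋯ < i_k}`. -/
noncomputable def eMon (n : ℕ) (I : Finset (Fin n)) : Lam n :=
  ((I.sort (· ≤ ·)).map fun j => ExteriorAlgebra.ι ℂ (Pi.single j 1)).prod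

/-- The interior product (contraction) `∂_j` with the `j`-th coordinate functional. -/
noncomputable def der (n : ℕ) (j : Fin n) : Module.End ℂ (Lam n) :=
  CliffordAlgebra.contractLeft (Q := (0 : QuadraticForm ℂ (Fin n → ℂ)))
    (LinearMap.proj j)

/-- The operator `L_j x = ι(e_j) * x + i • ∂_j x`. -/
noncomputable def Lop (n : ℕ) (j : Fin n) : Module.End ℂ (Lam n) :=
  LinearMap.mulLeft ℂ (ExteriorAlgebra.ι ℂ (Pi.single j 1)) + Complex.I • der n j

/-- The elementary Berezin–Fourier operator `F = (−i)ⁿ • (L_n ∘ ⋯ ∘ L₁)`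
(apply `L₁` first, then `L₂`, …, then `L_n`). -/
noncomputable def Fop (n : ℕ) : Module.End ℂ (Lam n) :=
  (-Complex.I) ^ n • ((List.ofFn (Lop n)).reverse).prod

/-- `ε(I,J)` = the number of pairs `(i,j) ∈ I × J` with `j < i`. -/
def eps (n : ℕ) (I J : Finset (Fin n)) : ℕ :=
  ((I ×ˢ J).filter fun p => p.2 < p.1).card

/-- The span of the monomials `e^I` with `|I| ≡ α (mod 2)`: elements of parity `α`. -/
noncomputable def paritySpan (n : ℕ) (α : Fin 2) : Submodule ℂ (Lam n) :=
  Submodule.span ℂ (eMon n '' {I : Finset (Fin n) | I.card % 2 = (α : ℕ)})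

theorem eMon_empty (n : ℕ) : eMon n ∅ = 1 := by
  simp [eMon]

theorem eMon_insert_of_lt {n : ℕ} {a : Fin n} {s : Finset (Fin n)} (h : ∀ b ∈ s, a < b) :
    eMon n (insert a s) = ExteriorAlgebra.ι ℂ (Pi.single a 1) * eMon n s := by
  have ha : a ∉ s := fun has => lt_irrefl a (h a has)
  simp only [eMon]
  rw [Finset.sort_insert (· ≤ ·) (fun b hb => (h b hb).le) ha]
  simp

theorem ι_mul_ι_anticomm {n : ℕ} (v w : Fin n → ℂ) (x : Lam n) :
    ExteriorAlgebra.ι ℂ v * (ExteriorAlgebra.ι ℂ w * x) =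
      -(ExteriorAlgebra.ι ℂ w * (ExteriorAlgebra.ι ℂ v * x)) := by
  rw [← mul_assoc, ← mul_assoc, ← neg_mul,
    eq_neg_of_add_eq_zero_left (ExteriorAlgebra.ι_add_mul_swap v w)]

theorem filter_lt_insert_of_lt {n : ℕ} {a j : Fin n} {s : Finset (Fin n)}
    (ha : a ∉ s) (haj : a < j) :
    ((insert a s).filter (· < j)).card = (s.filter (· < j)).card + 1 := by
  rw [Finset.filter_insert, if_pos haj, Finset.card_insert_of_notMem (by simp [ha])]

theorem ι_mul_eMon {n : ℕ} (j : Fin n) (I : Finset (Fin n)) :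
    ExteriorAlgebra.ι ℂ (Pi.single j 1) * eMon n I =
      if j ∈ I then 0 else (-1 : ℂ) ^ (I.filter (· < j)).card • eMon n (insert j I) := by
  induction I using Finset.induction_on_min with
  | empty => simp [← eMon_insert_of_lt]
  | insert a s has ih =>
    have ha : a ∉ s := fun h => lt_irrefl a (has a h)
    rcases lt_trichotomy j a with hja | rfl | haj
    · have hlt : ∀ b ∈ insert a s, j < b := by
        intro b hb
        rcases Finset.mem_insert.1 hb with rfl | hb
        · exact hja
        · exact hja.trans (has b hb)
      have hj : j ∉ insert a s := fun h => lt_irrefl j (hlt j h)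
      have hf : (insert a s).filter (· < j) = ∅ :=
        Finset.filter_eq_empty_iff.2 fun b hb => (hlt b hb).not_gt
      rw [if_neg hj, hf, eMon_insert_of_lt hlt]
      simp
    · rw [if_pos (Finset.mem_insert_self _ _), eMon_insert_of_lt has, ← mul_assoc,
        ExteriorAlgebra.ι_sq_zero, zero_mul]
    · rw [eMon_insert_of_lt has, ι_mul_ι_anticomm, ih, filter_lt_insert_of_lt ha haj]
      by_cases hjs : j ∈ s
      · simp [hjs]
      · have hlt : ∀ b ∈ insert j s, a < b := by
          intro b hb
          rcases Finset.mem_insert.1 hb with rfl | hb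
          · exact haj
          · exact has b hb
        rw [if_neg hjs, if_neg (by simp [hjs, haj.ne']), Finset.insert_comm,
          eMon_insert_of_lt hlt, pow_succ]
        simp

theorem der_eMon {n : ℕ} (j : Fin n) (I : Finset (Fin n)) :
    der n j (eMon n I) =
      if j ∈ I then (-1 : ℂ) ^ (I.filter (· < j)).card • eMon n (I.erase j) else 0 := by
  induction I using Finset.induction_on_min with
  | empty =>
    rw [eMon_empty]
    exact CliffordAlgebra.contractLeft_one (Q := (0 : QuadraticForm ℂ (Fin n → ℂ))) _
  | insert a s has ih =>
    have ha : a ∉ s := fun h => lt_irrefl a (has a h)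
    have key : der n j (eMon n (insert a s)) =
        (Pi.single a (1 : ℂ) : Fin n → ℂ) j • eMon n s -
          ExteriorAlgebra.ι ℂ (Pi.single a 1) * der n j (eMon n s) := by
      rw [eMon_insert_of_lt has]
      exact CliffordAlgebra.contractLeft_ι_mul _ _ _
    rw [key, ih]
    by_cases hja : j = a
    · subst hja
      have hf : (insert j s).filter (· < j) = ∅ := by
        refine Finset.filter_eq_empty_iff.2 fun b hb => ?_
        rcases Finset.mem_insert.1 hb with rfl | hb
        · exact lt_irrefl _
        · exact (has b hb).not_gt
      simp [ha, hf]
    · by_cases hjs : j ∈ s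
      · rw [filter_lt_insert_of_lt ha (has j hjs), if_pos hjs,
          if_pos (Finset.mem_insert_of_mem hjs), Finset.erase_insert_of_ne (Ne.symm hja),
          eMon_insert_of_lt fun b hb => has b (Finset.mem_of_mem_erase hb), pow_succ]
        simp [hja]
      · simp [hja, hjs]

theorem span_range_eMon (n : ℕ) : Submodule.span ℂ (Set.range (eMon n)) = ⊤ := by
  refine Submodule.eq_top_iff'.2 fun x => ?_
  have hmul : ∀ (v : Fin n → ℂ), ∀ y ∈ Submodule.span ℂ (Set.range (eMon n)),
      ExteriorAlgebra.ι ℂ v * y ∈ Submodule.span ℂ (Set.range (eMon n)) := by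
    intro v y hy
    induction hy using Submodule.span_induction with
    | mem y hy =>
      obtain ⟨I, rfl⟩ := hy
      rw [pi_eq_sum_univ' v, map_sum, Finset.sum_mul]
      refine Submodule.sum_mem _ fun j _ => ?_
      rw [map_smul, smul_mul_assoc, ι_mul_eMon]
      refine Submodule.smul_mem _ _ ?_
      split_ifs
      · exact Submodule.zero_mem _
      · exact Submodule.smul_mem _ _ (Submodule.subset_span ⟨_, rfl⟩)
    | zero => simp
    | add y z _ _ hy hz => rw [mul_add]; exact Submodule.add_mem _ hy hz
    | smul c y _ hy => rw [mul_smul_comm]; exact Submodule.smul_mem _ _ hy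
  refine CliffordAlgebra.left_induction (Q := (0 : QuadraticForm ℂ (Fin n → ℂ)))
    (P := fun x => x ∈ Submodule.span ℂ (Set.range (eMon n))) ?_ ?_ ?_ x
  · intro r
    rw [Algebra.algebraMap_eq_smul_one]
    exact Submodule.smul_mem _ _ (Submodule.subset_span ⟨∅, eMon_empty n⟩)
  · exact fun x y hx hy => Submodule.add_mem _ hx hy
  · exact fun x v hx => hmul v x hx

/-- The phase produced by the factor `L_j` of the Berezin–Fourier operator on `e^I`. -/
def fourierPhaseFactor {n : ℕ} (I : Finset (Fin n)) (j : Fin n) : ℂ :=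
  (if j ∈ I then Complex.I else 1) * (-1) ^ (Iᶜ.filter (· < j)).card

theorem take_reverse_prod_Lop_eMon (n : ℕ) (I : Finset (Fin n)) (m : ℕ) (hm : m ≤ n) :
    (((List.ofFn (Lop n)).take m).reverse).prod (eMon n I) =
      (∏ j with j.val < m, fourierPhaseFactor I j) •
        eMon n {j | ¬ (j ∈ I ↔ j.val < m)} := by
  induction m with
  | zero => simp
  | succ m ih =>
    obtain ⟨k, rfl⟩ : ∃ k : Fin n, k.val = m := ⟨⟨m, hm⟩, rfl⟩
    have hlen : k.val < (List.ofFn (Lop n)).length := by simp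
    have hsucc : ∀ j : Fin n, j.val < k.val + 1 ↔ j = k ∨ j.val < k.val := by
      intro j
      rw [Fin.ext_iff]
      omega
    have hprod : ∏ j : Fin n with j.val < k.val + 1, fourierPhaseFactor I j =
        fourierPhaseFactor I k * ∏ j : Fin n with j.val < k.val, fourierPhaseFactor I j := by
      have : (Finset.univ.filter fun j : Fin n => j.val < k.val + 1) =
          insert k (Finset.univ.filter fun j : Fin n => j.val < k.val) := by
        ext j
        simp only [Finset.mem_filter, Finset.mem_univ, true_and, Finset.mem_insert, hsucc]
      rw [this, Finset.prod_insert (by simp)]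
    have hcard : ((Finset.univ.filter fun j : Fin n => ¬ (j ∈ I ↔ j.val < k.val)).filter
        (· < k)) = Iᶜ.filter (· < k) := by
      ext j
      simp only [Finset.mem_filter, Finset.mem_univ, true_and, Finset.mem_compl, Fin.lt_def]
      tauto
    rw [List.take_succ_eq_append_getElem hlen, List.reverse_append, List.prod_append,
      Module.End.mul_apply, ih (by omega), map_smul, hprod, mul_comm, mul_smul]
    congr 1
    simp only [List.reverse_cons, List.reverse_nil, List.nil_append, List.prod_singleton,
      List.getElem_ofFn, Lop, LinearMap.add_apply, LinearMap.mulLeft_apply,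
      LinearMap.smul_apply, Fin.eta]
    rw [ι_mul_eMon, der_eMon, hcard, fourierPhaseFactor]
    have hmem : k ∈ (Finset.univ.filter fun j : Fin n => ¬ (j ∈ I ↔ j.val < k.val)) ↔ k ∈ I := by
      simp
    simp only [hmem]
    by_cases hkI : k ∈ I
    · have hset : (Finset.univ.filter fun j : Fin n => ¬ (j ∈ I ↔ j.val < k.val)).erase k =
          Finset.univ.filter fun j : Fin n => ¬ (j ∈ I ↔ j.val < k.val + 1) := by
        ext j
        simp only [Finset.mem_erase, Finset.mem_filter, Finset.mem_univ, true_and, hsucc]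
        by_cases hjk : j = k <;> simp [hjk, hkI]
      rw [if_pos hkI, if_pos hkI, if_pos hkI, hset, zero_add, smul_smul]
    · have hset : insert k (Finset.univ.filter fun j : Fin n => ¬ (j ∈ I ↔ j.val < k.val)) =
          Finset.univ.filter fun j : Fin n => ¬ (j ∈ I ↔ j.val < k.val + 1) := by
        ext j
        simp only [Finset.mem_insert, Finset.mem_filter, Finset.mem_univ, true_and, hsucc]
        by_cases hjk : j = k <;> simp [hjk, hkI]
      rw [if_neg hkI, if_neg hkI, if_neg hkI, hset, smul_zero, add_zero, one_mul]

/-- The phase of the Berezin–Fourier transform of `e^I`. -/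
def fourierPhase {n : ℕ} (I : Finset (Fin n)) : ℂ :=
  (-Complex.I) ^ n * ∏ j, fourierPhaseFactor I j

theorem Fop_eMon (n : ℕ) (I : Finset (Fin n)) :
    Fop n (eMon n I) = fourierPhase I • eMon n Iᶜ := by
  have h := take_reverse_prod_Lop_eMon n I n le_rfl
  rw [List.take_of_length_le (by simp)] at h
  have hset : (Finset.univ.filter fun j : Fin n => ¬ (j ∈ I ↔ j.val < n)) = Iᶜ := by
    ext j
    simp
  rw [Fop, LinearMap.smul_apply, h, hset, smul_smul, fourierPhase,
    Finset.filter_true_of_mem fun j _ => j.isLt]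

theorem conj_fourierPhase_mul {n : ℕ} (I J : Finset (Fin n)) :
    (starRingEnd ℂ) (fourierPhase I) * fourierPhase J =
      ∏ j, (starRingEnd ℂ) (fourierPhaseFactor I j) * fourierPhaseFactor J j := by
  have h : (Complex.I : ℂ) ^ n * (-Complex.I) ^ n = 1 := by
    rw [← mul_pow]
    simp
  rw [fourierPhase, fourierPhase, map_mul, map_pow, map_prod, map_neg, Complex.conj_I, neg_neg,
    mul_mul_mul_comm, h, one_mul, Finset.prod_mul_distrib]

theorem conj_fourierPhase_mul_self {n : ℕ} (I : Finset (Fin n)) :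
    (starRingEnd ℂ) (fourierPhase I) * fourierPhase I = 1 := by
  rw [conj_fourierPhase_mul]
  refine Finset.prod_eq_one fun j _ => ?_
  have h : ∀ k : ℕ, ((-1 : ℂ) ^ k) * (-1) ^ k = 1 := fun k => by
    rw [← mul_pow]
    simp
  rw [fourierPhaseFactor, map_mul, mul_mul_mul_comm, map_pow, map_neg, map_one, h]
  split_ifs <;> simp

theorem conj_fourierPhase_mul_compl {n : ℕ} (I : Finset (Fin n)) :
    (starRingEnd ℂ) (fourierPhase I) * fourierPhase Iᶜ = (-1) ^ I.card * Complex.I ^ (n * n) := by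
  have hfac : ∀ j : Fin n,
      (starRingEnd ℂ) (fourierPhaseFactor I j) * fourierPhaseFactor Iᶜ j =
        (if j ∈ I then -1 else 1) * (Complex.I * (-1) ^ j.val) := by
    intro j
    have hc : (Iᶜ.filter (· < j)).card + (I.filter (· < j)).card = j.val := by
      rw [add_comm, ← Finset.card_union_of_disjoint
        (Finset.disjoint_filter_filter disjoint_compl_right), ← Finset.filter_union,
        Finset.union_compl]
      rw [Finset.filter_gt_eq_Iio, Fin.card_Iio]
    rw [← hc, pow_add]
    simp only [fourierPhaseFactor, map_mul, map_pow, map_neg, map_one, compl_compl,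
      Finset.mem_compl]
    by_cases hj : j ∈ I
    · simp only [hj, if_true, not_true_eq_false, if_false, Complex.conj_I]
      ring
    · simp only [hj, if_false, not_false_eq_true, if_true, map_one]
      ring
  have hsum : ∀ m : ℕ, ∏ j ∈ Finset.range m, (Complex.I * (-1) ^ j) = Complex.I ^ (m * m) := by
    intro m
    induction m with
    | zero => simp
    | succ m ih =>
      rw [Finset.prod_range_succ, ih, ← Complex.I_sq]
      ring
  rw [conj_fourierPhase_mul, Finset.prod_congr rfl fun j _ => hfac j, Finset.prod_mul_distrib,
    Fin.prod_univ_eq_prod_range (fun j => Complex.I * (-1) ^ j) n, hsum, Finset.prod_ite]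
  simp

theorem eps_add_eps_compl (n : ℕ) (I : Finset (Fin n)) :
    eps n I Iᶜ + eps n Iᶜ I = I.card * Iᶜ.card := by
  have hswap : eps n Iᶜ I = ((I ×ˢ Iᶜ).filter fun p => ¬ p.2 < p.1).card := by
    refine Finset.card_bij (fun p _ => p.swap) ?_ ?_ ?_
    · rintro ⟨a, b⟩ h
      simp only [Finset.mem_filter, Finset.mem_product, Prod.swap] at h ⊢
      exact ⟨⟨h.1.2, h.1.1⟩, h.2.not_gt⟩
    · exact fun p _ q _ h => Prod.swap_injective h
    · rintro ⟨a, b⟩ h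
      simp only [Finset.mem_filter, Finset.mem_product, Finset.mem_compl] at h
      refine ⟨(b, a), ?_, rfl⟩
      simp only [Finset.mem_filter, Finset.mem_product, Finset.mem_compl]
      refine ⟨⟨h.1.2, h.1.1⟩, lt_of_le_of_ne (not_lt.1 h.2) ?_⟩
      rintro rfl
      exact h.1.2 h.1.1
  rw [hswap, eps, Finset.card_filter_add_card_filter_not, Finset.card_product]

theorem neg_one_pow_eps_compl (n : ℕ) (I : Finset (Fin n)) :
    (-1 : ℂ) ^ I.card * (-1) ^ eps n Iᶜ I = (-1) ^ (n * I.card) * (-1) ^ eps n I Iᶜ := by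
  have hc : I.card + Iᶜ.card = n := by
    simp
  have he := eps_add_eps_compl n I
  rw [← pow_add, ← pow_add]
  apply neg_one_pow_congr
  have hn : n * I.card = I.card * I.card + I.card * Iᶜ.card := by
    rw [← mul_add, hc, mul_comm]
  have h3 : Even (I.card * I.card) ↔ Even I.card := by simp [Nat.even_mul]
  have h4 := congrArg Even he
  rw [hn]
  simp only [Nat.even_add, eq_iff_iff] at h4 ⊢
  tauto

theorem I_pow_mul_self (n : ℕ) :
    Complex.I ^ (n * n) = if Even n then (1 : ℂ) else Complex.I := by
  split_ifs with h
  · obtain ⟨k, rfl⟩ := h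
    rw [show (k + k) * (k + k) = 4 * (k * k) by ring, pow_mul, Complex.I_pow_four, one_pow]
  · obtain ⟨k, rfl⟩ := Nat.not_even_iff_odd.1 h
    rw [show (2 * k + 1) * (2 * k + 1) = 4 * (k * k + k) + 1 by ring, pow_succ, pow_mul,
      Complex.I_pow_four, one_pow, one_mul]

/-- Two sesquilinear forms that agree on monomials `e^I`, `e^J` with `I ∈ s` agree for all first
arguments in the span of `{e^I : I ∈ s}`. -/
theorem sesquilinear_eqOn_span {n : ℕ} {B C : Lam n →ₗ⋆[ℂ] Lam n →ₗ[ℂ] ℂ}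
    {s : Set (Finset (Fin n))}
    (h : ∀ I ∈ s, ∀ J, B (eMon n I) (eMon n J) = C (eMon n I) (eMon n J))
    {x : Lam n} (hx : x ∈ Submodule.span ℂ (eMon n '' s)) (y : Lam n) : B x y = C x y := by
  have hBC : Set.EqOn B C (Submodule.span ℂ (eMon n '' s)) := by
    refine LinearMap.eqOn_span ?_
    rintro _ ⟨I, hI, rfl⟩
    refine LinearMap.ext_on (span_range_eMon n) ?_
    rintro _ ⟨J, rfl⟩
    exact h I hI J
  rw [hBC hx]

theorem berezinFourier_equivalence (n : ℕ)
    (inn : Lam n →ₗ⋆[ℂ] Lam n →ₗ[ℂ] ℂ)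
    (hinn : ∀ I J : Finset (Fin n),
      inn (eMon n I) (eMon n J) = if I = J then (1 : ℂ) else 0)
    (S : Lam n →ₗ⋆[ℂ] Lam n →ₗ[ℂ] ℂ)
    (hS : ∀ I J : Finset (Fin n),
      S (eMon n I) (eMon n J) = if J = Iᶜ then (-1 : ℂ) ^ eps n I Iᶜ else 0) :
    (∀ x y : Lam n, inn (Fop n x) (Fop n y) = inn x y) ∧
    (∀ (α : Fin 2), ∀ x ∈ paritySpan n α, ∀ y : Lam n,
      S (Fop n x) (Fop n y) =
        (if Even n then (1 : ℂ) else Complex.I) * ((-1 : ℂ) ^ (n * (α : ℕ)) * S x y)) := by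
  refine ⟨fun x y => ?_, fun α x hx y => ?_⟩
  · have hx : x ∈ Submodule.span ℂ (eMon n '' Set.univ) := by
      rw [Set.image_univ, span_range_eMon]
      trivial
    refine sesquilinear_eqOn_span (B := (inn.comp (Fop n)).compl₂ (Fop n)) (C := inn)
      (fun I _ J => ?_) hx y
    simp only [LinearMap.compl₂_apply, LinearMap.comp_apply, Fop_eMon, map_smulₛₗ,
      LinearMap.smul_apply, smul_eq_mul, hinn, compl_inj_iff, RingHom.id_apply]
    split_ifs with hIJ
    · rw [hIJ, mul_one, mul_comm, conj_fourierPhase_mul_self]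
    · simp
  · refine (sesquilinear_eqOn_span (B := (S.comp (Fop n)).compl₂ (Fop n))
      (C := ((if Even n then (1 : ℂ) else Complex.I) * (-1) ^ (n * (α : ℕ))) • S)
      (fun I hI J => ?_) hx y).trans ?_
    · simp only [LinearMap.compl₂_apply, LinearMap.comp_apply, Fop_eMon, map_smulₛₗ,
        LinearMap.smul_apply, smul_eq_mul, hS, RingHom.id_apply, compl_compl]
      by_cases hIJ : J = Iᶜ
      · subst hIJ
        have hα : (-1 : ℂ) ^ (n * (α : ℕ)) = (-1) ^ (n * I.card) := by
          have hI' : I.card % 2 = (α : ℕ) := hI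
          rw [← hI']
          apply neg_one_pow_congr
          simp [Nat.even_iff]
        have hph := conj_fourierPhase_mul_compl I
        have hsign := neg_one_pow_eps_compl n I
        rw [I_pow_mul_self] at hph
        simp only [compl_compl, if_true]
        rw [hα]
        linear_combination (-1) ^ eps n Iᶜ I * hph +
          (if Even n then (1 : ℂ) else Complex.I) * hsign
      · have : Jᶜ ≠ I := fun h => hIJ (by rw [← h, compl_compl])
        simp [hIJ, this]
    · rw [LinearMap.smul_apply, LinearMap.smul_apply, smul_eq_mul, mul_assoc]

end
end

section
/- Orthogonality properties of the decomposition of the k-Fourier mode for n = 2: let k ∈ ℝ, k ≠ 0, and on ℂ⁴ define the inner product ⟪χ,ψ⟫ := conj(χ₀)ψ₀ + conj(χ₁)ψ₁ + conj(χ₂)ψ₂ + conj(χ₃)ψ₃ and the super scalar product S(χ,ψ) := conj(χ₀)ψ₃ + conj(χ₁)ψ₂ − conj(χ₂)ψ₁ + conj(χ₃)ψ₀. With V_ε := span{(1,0,0,−εk/2), (0,1,εi,0)} for ε ∈ {+1,−1}: (a) S(v,w) = 0 for all v ∈ V₊ and w ∈ V₋, and S(v,w) = 0 for all v ∈ V₋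 and w ∈ V₊ (the two subspaces are orthogonal with respect to S); (b) the restriction of S to each V_ε is nondegenerate: for every v ∈ V_ε, v ≠ 0, there exists w ∈ V_ε with S(v,w) ≠ 0; (c) ⟪v,w⟫ = 0 for all v ∈ V₊, w ∈ V₋ if and only if k² = 4. -/
/-!
Statement 16: orthogonality properties of the decomposition `ℂ⁴ = V₊ ⊕ V₋` of the
`k`-Fourier mode for `n = 2`, with respect to the inner product `⟪·,·⟫` and the super
scalar product `S`.
-/

noncomputable section

open scoped BigOperators

/-- `V_ε = span{(1,0,0,−εk/2), (0,1,εi,0)}`. -/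
def Vsp (k ε : ℝ) : Submodule ℂ (Fin 4 → ℂ) :=
  Submodule.span ℂ
    {![1, 0, 0, -((ε : ℂ) * (k : ℂ)) / 2], ![0, 1, (ε : ℂ) * Complex.I, 0]}

/-- The inner product `⟪χ,ψ⟫ = Σ_j conj(χ_j)·ψ_j` on `ℂ⁴`. -/
def inn4 (χ ψ : Fin 4 → ℂ) : ℂ :=
  ∑ j : Fin 4, (starRingEnd ℂ) (χ j) * ψ j

/-- The super scalar product
`S(χ,ψ) = conj(χ₀)ψ₃ + conj(χ₁)ψ₂ − conj(χ₂)ψ₁ + conj(χ₃)ψ₀` on `ℂ⁴`. -/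
def S4 (χ ψ : Fin 4 → ℂ) : ℂ :=
  (starRingEnd ℂ) (χ 0) * ψ 3 + (starRingEnd ℂ) (χ 1) * ψ 2
    - (starRingEnd ℂ) (χ 2) * ψ 1 + (starRingEnd ℂ) (χ 3) * ψ 0

/-- Coordinates on `V_ε` with respect to its spanning pair. -/
theorem mem_Vsp_iff {k ε : ℝ} {v : Fin 4 → ℂ} :
    v ∈ Vsp k ε ↔
      ∃ a b : ℂ, v = ![a, b, (ε : ℂ) * Complex.I * b, -((ε : ℂ) * (k : ℂ)) / 2 * a] := by
  rw [Vsp, Submodule.mem_span_pair]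
  refine exists_congr fun a => exists_congr fun b => ?_
  rw [eq_comm]
  simp [mul_comm]

theorem S4_coords (k ε δ : ℝ) (a b c d : ℂ) :
    S4 ![a, b, (ε : ℂ) * Complex.I * b, -((ε : ℂ) * (k : ℂ)) / 2 * a]
        ![c, d, (δ : ℂ) * Complex.I * d, -((δ : ℂ) * (k : ℂ)) / 2 * c] =
      ((ε : ℂ) + δ) * (-(k : ℂ) / 2 * ((starRingEnd ℂ) a * c)
        + Complex.I * ((starRingEnd ℂ) b * d)) := by
  simp [S4, map_ofNat (starRingEnd ℂ) 2]
  ring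

theorem inn4_coords (k ε δ : ℝ) (a b c d : ℂ) :
    inn4 ![a, b, (ε : ℂ) * Complex.I * b, -((ε : ℂ) * (k : ℂ)) / 2 * a]
        ![c, d, (δ : ℂ) * Complex.I * d, -((δ : ℂ) * (k : ℂ)) / 2 * c] =
      (1 + (ε : ℂ) * δ * k ^ 2 / 4) * ((starRingEnd ℂ) a * c)
        + (1 + (ε : ℂ) * δ) * ((starRingEnd ℂ) b * d) := by
  simp [inn4, Fin.sum_univ_four, map_ofNat (starRingEnd ℂ) 2]
  linear_combination
    (-(ε : ℂ) * δ * (starRingEnd ℂ) b * d) * Complex.I_sq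

theorem kFourierMode_orthogonality (k : ℝ) (hk : k ≠ 0) :
    -- (a) `V₊` and `V₋` are orthogonal with respect to `S`
    ((∀ v ∈ Vsp k 1, ∀ w ∈ Vsp k (-1), S4 v w = 0) ∧
      (∀ v ∈ Vsp k (-1), ∀ w ∈ Vsp k 1, S4 v w = 0)) ∧
    -- (b) the restriction of `S` to each `V_ε` is nondegenerate
    (∀ ε : ℝ, ε = 1 ∨ ε = -1 →
      ∀ v ∈ Vsp k ε, v ≠ 0 → ∃ w ∈ Vsp k ε, S4 v w ≠ 0) ∧
    -- (c) `V₊ ⊥ V₋` with respect to `⟪·,·⟫` if and only if `k² = 4`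
    ((∀ v ∈ Vsp k 1, ∀ w ∈ Vsp k (-1), inn4 v w = 0) ↔ k ^ 2 = 4) := by
  refine ⟨⟨?_, ?_⟩, ?_, ?_, ?_⟩
  · intro v hv w hw
    obtain ⟨a, b, rfl⟩ := mem_Vsp_iff.1 hv
    obtain ⟨c, d, rfl⟩ := mem_Vsp_iff.1 hw
    rw [S4_coords]
    simp
  · intro v hv w hw
    obtain ⟨a, b, rfl⟩ := mem_Vsp_iff.1 hv
    obtain ⟨c, d, rfl⟩ := mem_Vsp_iff.1 hw
    rw [S4_coords]
    simp
  · intro ε hε v hv hne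
    obtain ⟨a, b, rfl⟩ := mem_Vsp_iff.1 hv
    have hε0 : (ε : ℂ) ≠ 0 := by
      rcases hε with rfl | rfl <;> simp
    have hkC : (k : ℂ) ≠ 0 := by exact_mod_cast hk
    by_cases ha : a = 0
    · have hb : b ≠ 0 := by
        rintro rfl
        apply hne
        ext j
        fin_cases j <;> simp [ha]
      refine ⟨_, mem_Vsp_iff.2 ⟨0, 1, rfl⟩, ?_⟩
      rw [S4_coords, ← two_mul]
      simp [hε0, hb]
    · refine ⟨_, mem_Vsp_iff.2 ⟨1, 0, rfl⟩, ?_⟩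
      rw [S4_coords, ← two_mul]
      simp [hε0, ha, hkC]
  · intro h
    have h₀ := h _ (mem_Vsp_iff.2 ⟨1, 0, rfl⟩) _ (mem_Vsp_iff.2 ⟨1, 0, rfl⟩)
    rw [inn4_coords] at h₀
    have h₁ : (k : ℂ) ^ 2 = 4 := by
      simp at h₀
      linear_combination -4 * h₀
    exact_mod_cast h₁
  · intro h v hv w hw
    obtain ⟨a, b, rfl⟩ := mem_Vsp_iff.1 hv
    obtain ⟨c, d, rfl⟩ := mem_Vsp_iff.1 hw
    have hkC : (k : ℂ) ^ 2 = 4 := by exact_mod_cast h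
    rw [inn4_coords, hkC]
    simp

end
end
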